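/- Let K be a group, let c, d be automorphisms of K, and let s ∈ K be such that c³ ∘ d⁻² equals conjugation by s, i.e., c³(d⁻²(k)) = s * k * s⁻¹ for all k ∈ K. Let F = FreeGroup Bool with generators a = FreeGroup.of true and b = FreeGroup.of false, let θ : F → Aut K be the homomorphism with θ(a) = c and θ(b) = d, and form the semidirect product K ⋊[θ] F with canonical injections inl : K → K ⋊[θ] F and inr : F → K ⋊[θ] F. Let E be the quotient of K ⋊[θ] F by the normal closure of the single element inr(a³ * b⁻²) * (inl s)⁻¹ (imposing the relation a³b⁻² = s). Then: (i) the composite homomorphism K → K ⋊[θ] F → E is injective; (ii) its image is a normal subgroup of E; and (iii) the quotient of E by this image is isomorphic to the trefoil group T = PresentedGroup {a³ * b⁻²}. In other words, E is an extension 1 → K → E → T → 1 of T by K. -/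

import Mathlib

namespace SemidirectProduct

universe u

variable {K : Type u} [Group K]

/-- If `β` is `α ^ n` followed by conjugation by `σ`, then the identity of `K` extends to a
homomorphism `K ⋊[β] ℤ →* K ⋊[α] ℤ` sending the generator `1` of `ℤ` to `(σ, n)`. -/
def mapTwistedPow (β α : MulAut K) (σ : K) (n : ℤ)
    (h : ∀ k, β k = σ * (α ^ n) k * σ⁻¹) :
    K ⋊[zpowersHom (MulAut K) β] Multiplicative ℤ →*
      K ⋊[zpowersHom (MulAut K) α] Multiplicative ℤ :=
  lift inl (zpowersHom _ (inl σ * inr (Multiplicative.ofAdd n))) <| by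
    have key : (MulAut.conj (inl σ * inr (Multiplicative.ofAdd n) :
        K ⋊[zpowersHom (MulAut K) α] Multiplicative ℤ)).toMonoidHom.comp inl =
        inl.comp β.toMonoidHom := by
      ext k <;> simp [h, mul_assoc]
    intro g
    induction g using Multiplicative.rec with | ofAdd m => ?_
    simp only [zpowersHom_apply, toAdd_ofAdd]
    induction m using Int.induction_on with
    | zero => ext <;> simp
    | succ m ih =>
      ext1 k
      have h1 := DFunLike.congr_fun key k
      have h2 := DFunLike.congr_fun ih (β k)
      simp only [MonoidHom.comp_apply, MulEquiv.coe_toMonoidHom] at h1 h2 ⊢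
      rw [zpow_add_one, zpow_add_one, map_mul, MulAut.mul_apply, MulAut.mul_apply, h1, h2]
    | pred m ih =>
      ext1 k
      have h1 := DFunLike.congr_fun key (β⁻¹ k)
      have h2 := DFunLike.congr_fun ih (β⁻¹ k)
      simp only [MonoidHom.comp_apply, MulEquiv.coe_toMonoidHom, MulAut.apply_inv_self]
        at h1 h2 ⊢
      rw [zpow_sub_one, zpow_sub_one, map_mul, MulAut.mul_apply, MulAut.mul_apply, ← h1,
        h2, map_inv, MulAut.inv_apply_self]

section

variable (β α : MulAut K) (σ : K) (n : ℤ) (h : ∀ k, β k = σ * (α ^ n) k * σ⁻¹)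

@[simp]
theorem mapTwistedPow_inl (k : K) : mapTwistedPow β α σ n h (inl k) = inl k := by
  simp [mapTwistedPow]

@[simp]
theorem mapTwistedPow_inr_ofAdd_one :
    mapTwistedPow β α σ n h (inr (Multiplicative.ofAdd 1)) =
      inl σ * inr (Multiplicative.ofAdd n) := by
  simp [mapTwistedPow]

theorem mapTwistedPow_injective (hn : n ≠ 0) :
    Function.Injective (mapTwistedPow β α σ n h) := by
  have hr : ∀ x, (mapTwistedPow β α σ n h x).right = x.right ^ n := fun x => by
    have : (mapTwistedPow β α σ n h x).right =
        (Multiplicative.ofAdd n) ^ (Multiplicative.toAdd x.right) := by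
      change rightHom (mapTwistedPow β α σ n h x) = _
      simp [mapTwistedPow, lift, -rightHom_eq_right]
    rw [this]
    apply Multiplicative.toAdd.injective
    simp [mul_comm]
  rw [injective_iff_map_eq_one]
  intro x hx
  have h1 : x.right = 1 := by
    have h2 := hr x
    rw [hx, one_right] at h2
    apply Multiplicative.toAdd.injective
    have h3 := congrArg Multiplicative.toAdd h2
    simpa [hn] using h3.symm
  obtain ⟨k, rfl⟩ : ∃ k, inl k = x := ⟨x.left, by ext <;> simp [h1]⟩
  rw [mapTwistedPow_inl, ← map_one inl, inl_inj] at hx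
  rw [hx, map_one]

end

/-- If the automorphisms `c = θ(a)` and `d = θ(b)` satisfy `c³d⁻² = conj s`, there is a group
containing `K` which is a target of `K ⋊[θ] F` where `a³b⁻² = s`: the amalgamated product of
`K ⋊[c] ℤ` and `K ⋊[d] ℤ` in which `a³` is identified with `s b²`. -/
theorem exists_hom_injective_of_cocycle (θ : FreeGroup Bool →* MulAut K) (s : K)
    (h : ∀ k, (θ (FreeGroup.of true) ^ (3 : ℤ)) k =
      s * (θ (FreeGroup.of false) ^ (2 : ℤ)) k * s⁻¹) :
    ∃ (P : Type u) (_ : Group P) (f : K ⋊[θ] FreeGroup Bool →* P),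
      Function.Injective (f.comp inl) ∧
      f (inr (FreeGroup.of true ^ 3 * (FreeGroup.of false ^ 2)⁻¹) * (inl s)⁻¹) = 1 := by
  let α : Bool → MulAut K := fun i => θ (FreeGroup.of i)
  let β : MulAut K := α true ^ (3 : ℤ)
  let G : Bool → Type u := fun i => K ⋊[zpowersHom (MulAut K) (α i)] Multiplicative ℤ
  let σ : Bool → K := fun i => bif i then 1 else s
  let n : Bool → ℤ := fun i => bif i then 3 else 2
  have hβ : ∀ i k, β k = σ i * (α i ^ n i) k * (σ i)⁻¹ := by
    rintro (_ | _) k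
    · exact h k
    · simp [σ, n, β]
  let φ : ∀ i, K ⋊[zpowersHom (MulAut K) β] Multiplicative ℤ →* G i := fun i =>
    mapTwistedPow β (α i) (σ i) (n i) (hβ i)
  have hφ : ∀ i, Function.Injective (φ i) := fun i =>
    mapTwistedPow_injective _ _ _ _ _ (by cases i <;> simp [n])
  let ι : K →* Monoid.PushoutI φ := (Monoid.PushoutI.base φ).comp inl
  let gen : ∀ i, G i := fun _ => inr (Multiplicative.ofAdd 1)
  let ψ : FreeGroup Bool →* Monoid.PushoutI φ :=
    FreeGroup.lift fun i => Monoid.PushoutI.of i (gen i)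
  have hι : ∀ i k, ι k = Monoid.PushoutI.of (φ := φ) i (inl k) := fun i k => by
    rw [← mapTwistedPow_inl β (α i) (σ i) (n i) (hβ i) k]
    exact (Monoid.PushoutI.of_apply_eq_base φ i _).symm
  have hψ : ∀ u, ι.comp (θ u).toMonoidHom = (MulAut.conj (ψ u)).toMonoidHom.comp ι := by
    have hgen : ∀ i k, ι (θ (FreeGroup.of i) k) =
        ψ (FreeGroup.of i) * ι k * (ψ (FreeGroup.of i))⁻¹ := fun i k => by
      rw [hι i, hι i, FreeGroup.lift_apply_of, ← map_inv, ← map_mul, ← map_mul]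
      refine congrArg _ ?_
      have := inl_aut (φ := zpowersHom (MulAut K) (α i)) (Multiplicative.ofAdd 1) k
      simpa [gen, α] using this
    intro u
    ext k
    change ι (θ u k) = ψ u * ι k * (ψ u)⁻¹
    induction u using FreeGroup.induction_on generalizing k with
    | C1 => simp
    | of i => exact hgen i k
    | inv_of i _ =>
      have := hgen i ((θ (FreeGroup.of i))⁻¹ k)
      rw [MulAut.apply_inv_self] at this
      rw [this]
      simp [mul_assoc]
    | mul u v hu hv => simp [hu, hv, mul_assoc]
  refine ⟨Monoid.PushoutI φ, inferInstance, lift ι ψ hψ, ?_, ?_⟩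
  · rw [lift_comp_inl]
    exact (Monoid.PushoutI.base_injective hφ).comp inl_injective
  · have ht : ∀ i, Monoid.PushoutI.base φ (inr (Multiplicative.ofAdd 1)) =
        ι (σ i) * ψ (FreeGroup.of i) ^ (n i) := fun i => by
      rw [← Monoid.PushoutI.of_apply_eq_base φ i, hι i]
      have hg : gen i ^ n i = inr (Multiplicative.ofAdd (n i)) := by
        simp [gen, ← map_zpow, ← ofAdd_zsmul]
      rw [FreeGroup.lift_apply_of, ← map_zpow, hg, ← map_mul]
      exact congrArg _ (mapTwistedPow_inr_ofAdd_one _ _ _ _ _)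
    have h3 := (ht true).symm.trans (ht false)
    simp only [σ, n, cond_true, cond_false, map_one, one_mul] at h3
    have h4 : ψ (FreeGroup.of true) ^ 3 = ι s * ψ (FreeGroup.of false) ^ 2 := by
      exact_mod_cast h3
    simp [h4]

end SemidirectProduct

/-- STATEMENT 18: Given 2-cocycle data `(s, c, d)` on the trefoil group
`T = ⟨a, b | a³b⁻²⟩` with values in a group `K` (automorphisms `c, d` of `K` and `s ∈ K`
with `c³ ∘ d⁻²` equal to conjugation by `s`), the quotient `E` of the semidirect product
`K ⋊[θ] FreeGroup Bool` (where `θ(a) = c`, `θ(b) = d`) by the normal closure of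
`inr (a³b⁻²) * (inl s)⁻¹` is an extension `1 → K → E → T → 1`:
(i) `K → E` is injective; (ii) its image is normal in `E`; (iii) `E` modulo this image is
isomorphic to `T` (expressed via a surjection `q : E → T` with kernel this image). -/
theorem trefoil_extension_from_cocycle
    {K : Type} [Group K] (c d : MulAut K) (s : K)
    (hcd : ∀ k : K, c (c (c (d⁻¹ (d⁻¹ k)))) = s * k * s⁻¹)
    (θ : FreeGroup Bool →* MulAut K)
    (hθa : θ (FreeGroup.of true) = c) (hθb : θ (FreeGroup.of false) = d)
    (N : Subgroup (K ⋊[θ] FreeGroup Bool))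
    (hN : N = Subgroup.normalClosure
      {SemidirectProduct.inr (FreeGroup.of true ^ 3 * (FreeGroup.of false ^ 2)⁻¹) *
        (SemidirectProduct.inl s)⁻¹})
    [N.Normal] :
    Function.Injective ((QuotientGroup.mk' N).comp SemidirectProduct.inl) ∧
    ((QuotientGroup.mk' N).comp SemidirectProduct.inl).range.Normal ∧
    ∃ q : (K ⋊[θ] FreeGroup Bool) ⧸ N →*
        PresentedGroup
          ({FreeGroup.of true ^ 3 * (FreeGroup.of false ^ 2)⁻¹} : Set (FreeGroup Bool)),
      Function.Surjective q ∧
      q.ker = ((QuotientGroup.mk' N).comp SemidirectProduct.inl).range := by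
  subst hθa hθb
  obtain ⟨P, _, f, hf, hfr⟩ := SemidirectProduct.exists_hom_injective_of_cocycle θ s fun k => by
    rw [← hcd]
    simp [zpow_ofNat, pow_succ]
  have hNf : N ≤ f.ker := by
    rw [hN]
    exact Subgroup.normalClosure_le_normal (by simpa using hfr)
  have hrange : ((QuotientGroup.mk' N).comp SemidirectProduct.inl).range =
      (SemidirectProduct.rightHom (φ := θ)).ker.map (QuotientGroup.mk' N) := by
    rw [← SemidirectProduct.range_inl_eq_ker_rightHom, MonoidHom.range_comp]
  have hmap : N.map SemidirectProduct.rightHom = Subgroup.normalClosure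
      {FreeGroup.of true ^ 3 * (FreeGroup.of false ^ 2)⁻¹} := by
    rw [hN, Subgroup.map_normalClosure _ _ SemidirectProduct.rightHom_surjective,
      Set.image_singleton, map_mul, map_inv, SemidirectProduct.rightHom_inr,
      SemidirectProduct.rightHom_inl, inv_one, mul_one]
  refine ⟨?_, ?_, QuotientGroup.map N _ SemidirectProduct.rightHom
    (Subgroup.map_le_iff_le_comap.1 hmap.le), ?_, ?_⟩
  · refine Function.Injective.of_comp (f := QuotientGroup.lift N f hNf) ?_
    exact hf
  · rw [hrange]
    exact (MonoidHom.normal_ker _).map _ (QuotientGroup.mk'_surjective N)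
  · exact QuotientGroup.map_surjective_of_surjective _ _ _
      ((QuotientGroup.mk'_surjective _).comp SemidirectProduct.rightHom_surjective) _
  · rw [hrange]
    refine (QuotientGroup.ker_map _ _ _ _).trans ?_
    rw [← hmap, Subgroup.comap_map_eq, Subgroup.map_sup, QuotientGroup.map_mk'_self, bot_sup_eq]
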